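/- arXiv:2111.12823 — 6 statements merged into one kernel-verified Lean document; each statement's English description precedes it below -/
import Mathlib

section
/- Let X0 and X1 be independent ℝ^d-valued Gaussian random vectors with means μ0 and μ1 and covariance matrices Σ0 and Σ1, respectively, such that μ1 ≠ μ0 and Σ := Σ0 + Σ1 is positive definite. Let w := Σ⁻¹(μ1 − μ0) be the Fisher linear discriminant direction. Then the probability that ⟨w, X1⟩ > ⟨w, X0⟩ equals Φ(√((μ1 − μ0)ᵀ Σ⁻¹ (μ1 − μ0))). -/
open MeasureTheory ProbabilityTheory Matrix

/-- The cumulative distribution function of the standard normal distribution. -/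
noncomputable def stdNormalCDF (x : ℝ) : ℝ :=
  (ProbabilityTheory.gaussianReal 0 1 (Set.Iic x)).toReal

/-- `X : Ω → ℝ^d` is a Gaussian random vector with mean `μ` and covariance matrix `S`:
it is measurable and every linear projection `⟨v, X⟩` is Gaussian with mean `⟨v, μ⟩`
and variance `vᵀ S v`. -/
def IsGaussianVector {Ω : Type*} [MeasurableSpace Ω] (P : Measure Ω)
    {d : ℕ} (X : Ω → (Fin d → ℝ)) (μ : Fin d → ℝ) (S : Matrix (Fin d) (Fin d) ℝ) : Prop :=
  Measurable X ∧
    ∀ v : Fin d → ℝ,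
      P.map (fun ω => v ⬝ᵥ X ω) = gaussianReal (v ⬝ᵥ μ) (Real.toNNReal (v ⬝ᵥ S.mulVec v))

/-- A Gaussian variable `N(m, s²)` with `s > 0` is positive with probability `Φ(m / s)`. -/
theorem gaussianReal_Ioi_zero_eq_stdNormalCDF (m : ℝ) {s : ℝ} (hs : 0 < s) :
    (gaussianReal m (Real.toNNReal (s ^ 2)) (Set.Ioi 0)).toReal = stdNormalCDF (m / s) := by
  have hmap : (gaussianReal 0 1).map (fun z => m - s * z)
      = gaussianReal m (Real.toNNReal (s ^ 2)) := by
    have hcomp : (fun z : ℝ => m - s * z) = (fun x => m - x) ∘ fun z => s * z := rfl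
    rw [hcomp, ← Measure.map_map (by fun_prop) (by fun_prop), gaussianReal_map_const_mul,
      gaussianReal_map_const_sub]
    congr 1
    · simp
    · ext
      simp [sq_nonneg]
  have hpre : (fun z : ℝ => m - s * z) ⁻¹' Set.Ioi 0 = Set.Iio (m / s) := by
    ext z
    simp [lt_div_iff₀ hs, mul_comm]
  have := nullSingletonClass_gaussianReal (μ := 0) (v := 1) one_ne_zero
  rw [← hmap, Measure.map_apply (by fun_prop) measurableSet_Ioi, hpre, stdNormalCDF,
    measure_congr Iio_ae_eq_Iic]

/-- The difference of the projections of two independent Gaussian vectors on a direction `w` is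
Gaussian with mean `⟨w, μ1 − μ0⟩` and variance `wᵀ (S0 + S1) w`. -/
theorem IsGaussianVector.map_dotProduct_sub {Ω : Type*} [MeasurableSpace Ω] {P : Measure Ω}
    {d : ℕ} {X0 X1 : Ω → (Fin d → ℝ)} {μ0 μ1 : Fin d → ℝ} {S0 S1 : Matrix (Fin d) (Fin d) ℝ}
    (hS0 : S0.PosSemidef) (hS1 : S1.PosSemidef)
    (hG0 : IsGaussianVector P X0 μ0 S0) (hG1 : IsGaussianVector P X1 μ1 S1)
    (hindep : IndepFun X0 X1 P) (w : Fin d → ℝ) :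
    P.map (fun ω => w ⬝ᵥ X1 ω - w ⬝ᵥ X0 ω)
      = gaussianReal (w ⬝ᵥ (μ1 - μ0)) (Real.toNNReal (w ⬝ᵥ (S0 + S1).mulVec w)) := by
  have hw : ∀ u : Fin d → ℝ, Measurable fun x : Fin d → ℝ => u ⬝ᵥ x := fun u => by
    unfold dotProduct
    fun_prop
  have hind : IndepFun (fun ω => w ⬝ᵥ X1 ω) (fun ω => (-w) ⬝ᵥ X0 ω) P :=
    hindep.symm.comp (hw w) (hw (-w))
  have hfun : (fun ω => w ⬝ᵥ X1 ω - w ⬝ᵥ X0 ω)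
      = (fun ω => w ⬝ᵥ X1 ω) + fun ω => (-w) ⬝ᵥ X0 ω := by
    ext ω
    simp [sub_eq_add_neg]
  have h0 : 0 ≤ w ⬝ᵥ S0.mulVec w := by simpa using hS0.dotProduct_mulVec_nonneg w
  have h1 : 0 ≤ w ⬝ᵥ S1.mulVec w := by simpa using hS1.dotProduct_mulVec_nonneg w
  rw [hfun, gaussianReal_add_gaussianReal_of_indepFun hind (hG1.2 w) (hG0.2 (-w))]
  congr 1
  · simp [sub_eq_add_neg]
  · rw [add_mulVec, dotProduct_add, Real.toNNReal_add h0 h1]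
    simp [mulVec_neg, add_comm]

/-- **AUC of the Fisher linear discriminant.** For independent Gaussian vectors
`X0 ~ N(μ0, Σ0)` and `X1 ~ N(μ1, Σ1)` with `μ1 ≠ μ0` and `Σ = Σ0 + Σ1` positive definite,
the FLD direction `w = Σ⁻¹(μ1 − μ0)` satisfies
`P(⟨w, X1⟩ > ⟨w, X0⟩) = Φ(√((μ1 − μ0)ᵀ Σ⁻¹ (μ1 − μ0)))`. -/
theorem fld_auc
    {Ω : Type*} [MeasurableSpace Ω] (P : Measure Ω) [IsProbabilityMeasure P]
    {d : ℕ} (X0 X1 : Ω → (Fin d → ℝ)) (μ0 μ1 : Fin d → ℝ)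
    (S0 S1 : Matrix (Fin d) (Fin d) ℝ)
    (hS0 : S0.PosSemidef) (hS1 : S1.PosSemidef)
    (hG0 : IsGaussianVector P X0 μ0 S0) (hG1 : IsGaussianVector P X1 μ1 S1)
    (hindep : IndepFun X0 X1 P)
    (hμ : μ1 ≠ μ0) (hS : (S0 + S1).PosDef) :
    (P {ω | ((S0 + S1)⁻¹.mulVec (μ1 - μ0)) ⬝ᵥ X1 ω
            > ((S0 + S1)⁻¹.mulVec (μ1 - μ0)) ⬝ᵥ X0 ω}).toReal
      = stdNormalCDF (Real.sqrt ((μ1 - μ0) ⬝ᵥ (S0 + S1)⁻¹.mulVec (μ1 - μ0))) := by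
  set w := (S0 + S1)⁻¹.mulVec (μ1 - μ0) with hw
  set q := (μ1 - μ0) ⬝ᵥ w with hq
  have hq_pos : 0 < q := by
    simpa only [star_trivial] using hS.inv.dotProduct_mulVec_pos (sub_ne_zero.mpr hμ)
  have hSw : (S0 + S1).mulVec w = μ1 - μ0 := by
    rw [hw, mulVec_mulVec, mul_nonsing_inv _ ((isUnit_iff_isUnit_det _).mp hS.isUnit), one_mulVec]
  have hmap := hG0.map_dotProduct_sub hS0 hS1 hG1 hindep w
  rw [hSw, dotProduct_comm, ← hq] at hmap
  have hmeas : Measurable fun ω => w ⬝ᵥ X1 ω - w ⬝ᵥ X0 ω := by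
    have h0 := hG0.1
    have h1 := hG1.1
    unfold dotProduct
    fun_prop
  have hset : {ω | w ⬝ᵥ X1 ω > w ⬝ᵥ X0 ω}
      = (fun ω => w ⬝ᵥ X1 ω - w ⬝ᵥ X0 ω) ⁻¹' Set.Ioi 0 := by
    ext ω
    simp
  have hΦ := gaussianReal_Ioi_zero_eq_stdNormalCDF q (Real.sqrt_pos.mpr hq_pos)
  rw [Real.sq_sqrt hq_pos.le, Real.div_sqrt] at hΦ
  rw [hset, ← Measure.map_apply hmeas measurableSet_Ioi, hmap, hΦ]
end

section
/- There exist π ∈ (0,1), a real number d > 0, and positive reals σ_{a0}², σ_{a1}², σ_{b0}², σ_{b1}² such that π·σ_{a1}² + (1−π)·σ_{a0}² > π·σ_{b1}² + (1−π)·σ_{b0}² (so that with common base rate π and common class-conditional mean gap d, group a has strictly larger unconditional variance than group b) while Φ(d/√(σ_{a0}² + σ_{a1}²)) < Φ(d/√(σ_{b0}² + σ_{b1}²)); and there also exist such parameters satisfying the same strict variance inequality but with Φ(d/√(σ_{a0}² + σ_{a1}²)) > Φ(d/√(σ_{b0}² + σ_{b1}²)). Hence the ranking of unconditional variances between two groups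 does not determine the ranking of their binormal AUCs. -/
open MeasureTheory ProbabilityTheory

/-- The standard normal distribution function is strictly increasing. -/
theorem stdNormalCDF_strictMono : StrictMono stdNormalCDF := by
  intro x y hxy
  unfold stdNormalCDF
  have hpos : 0 < (gaussianReal 0 1).real (Set.Ioc x y) := by
    refine ENNReal.toReal_pos (fun h => ?_) (measure_ne_top _ _)
    have hvol := gaussianReal_absolutelyContinuous' 0 one_ne_zero h
    rw [Real.volume_Ioc, ENNReal.ofReal_eq_zero] at hvol
    linarith
  have hadd : (gaussianReal 0 1).real (Set.Iic y) =
      (gaussianReal 0 1).real (Set.Iic x) + (gaussianReal 0 1).real (Set.Ioc x y) := by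
    rw [← Set.Iic_union_Ioc_eq_Iic hxy.le]
    exact measureReal_union (Set.Iic_disjoint_Ioc le_rfl) measurableSet_Ioc
  change (gaussianReal 0 1).real (Set.Iic x) < (gaussianReal 0 1).real (Set.Iic y)
  linarith

/-- For a fixed positive mean gap, a smaller total variance gives a larger binormal AUC. -/
theorem stdNormalCDF_div_sqrt_lt {d u v : ℝ} (hd : 0 < d) (hu : 0 < u) (huv : u < v) :
    stdNormalCDF (d / Real.sqrt v) < stdNormalCDF (d / Real.sqrt u) :=
  stdNormalCDF_strictMono <|
    div_lt_div_of_pos_left hd (Real.sqrt_pos.2 hu) (Real.sqrt_lt_sqrt hu.le huv)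

/-- **Unconditional variance does not determine the AUC ranking.** There are parameters
(base rate `p`, common mean gap `d`, and positive class-conditional variances for two
groups `a` and `b`) such that group `a` has strictly larger unconditional variance,
i.e. `p·σ_{a1}² + (1−p)·σ_{a0}² > p·σ_{b1}² + (1−p)·σ_{b0}²`, yet its binormal AUC
`Φ(d/√(σ_{a0}² + σ_{a1}²))` is strictly smaller than group `b`'s; and there are also
such parameters for which group `a`'s AUC is strictly larger. -/
theorem uncond_variance_not_informative :
    (∃ p d va0 va1 vb0 vb1 : ℝ,
        p ∈ Set.Ioo (0 : ℝ) 1 ∧ 0 < d ∧ 0 < va0 ∧ 0 < va1 ∧ 0 < vb0 ∧ 0 < vb1 ∧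
        p * va1 + (1 - p) * va0 > p * vb1 + (1 - p) * vb0 ∧
        stdNormalCDF (d / Real.sqrt (va0 + va1)) < stdNormalCDF (d / Real.sqrt (vb0 + vb1))) ∧
    (∃ p d va0 va1 vb0 vb1 : ℝ,
        p ∈ Set.Ioo (0 : ℝ) 1 ∧ 0 < d ∧ 0 < va0 ∧ 0 < va1 ∧ 0 < vb0 ∧ 0 < vb1 ∧
        p * va1 + (1 - p) * va0 > p * vb1 + (1 - p) * vb0 ∧
        stdNormalCDF (d / Real.sqrt (va0 + va1)) > stdNormalCDF (d / Real.sqrt (vb0 + vb1))) := by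
  refine ⟨⟨3 / 4, 1, 2, 2, 1, 1, ?_⟩, ⟨3 / 4, 1, 1, 4, 8, 1, ?_⟩⟩ <;>
    refine ⟨by norm_num, by norm_num, by norm_num, by norm_num, by norm_num, by norm_num,
      by norm_num, stdNormalCDF_div_sqrt_lt ?_ ?_ ?_⟩ <;>
    norm_num
end

section
/- For all real numbers γ with 0 < γ ≤ 1, all Δ0 > 0, all α with 0 < α < −2·ln(2γ), and all Δ ≥ Δ0, it holds that Φ(√(α + Δ)) − Φ(√α) ≥ (2/√π) · γ^{3/2} · Δ0 / ( √(2/e + Δ0) · (2 + Δ0) ). -/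
open MeasureTheory ProbabilityTheory

lemma stdNormalCDF_eq_integral (x : ℝ) :
    stdNormalCDF x = ∫ t in Set.Iic x, gaussianPDFReal 0 1 t := by
  rw [stdNormalCDF, gaussianReal_apply_eq_integral 0 one_ne_zero, ENNReal.toReal_ofReal]
  exact integral_nonneg fun t => gaussianPDFReal_nonneg 0 1 t

lemma stdNormalCDF_sub_eq_integral (a b : ℝ) :
    stdNormalCDF b - stdNormalCDF a = ∫ t in a..b, gaussianPDFReal 0 1 t := by
  rw [stdNormalCDF_eq_integral, stdNormalCDF_eq_integral]
  exact intervalIntegral.integral_Iic_sub_Iic (integrable_gaussianPDFReal 0 1).integrableOn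
    (integrable_gaussianPDFReal 0 1).integrableOn

lemma stdNormalCDF_mono : Monotone stdNormalCDF := fun _ _ h =>
  ENNReal.toReal_mono (measure_ne_top _ _) (measure_mono (Set.Iic_subset_Iic.2 h))

lemma integral_mul_exp_neg_sq_div_two (a b : ℝ) :
    ∫ t in a..b, t * Real.exp (-t ^ 2 / 2) = Real.exp (-a ^ 2 / 2) - Real.exp (-b ^ 2 / 2) := by
  have hderiv (t : ℝ) :
      HasDerivAt (fun t => -Real.exp (-t ^ 2 / 2)) (t * Real.exp (-t ^ 2 / 2)) t := by
    have hsq : HasDerivAt (fun t : ℝ => -t ^ 2 / 2) (-t) t := by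
      refine (((hasDerivAt_pow 2 t).neg).div_const 2).congr_deriv ?_
      norm_num
      ring
    exact hsq.exp.neg.congr_deriv (by ring)
  rw [intervalIntegral.integral_eq_sub_of_hasDerivAt (fun t _ => hderiv t)
    (Continuous.intervalIntegrable (by fun_prop) _ _)]
  ring

/-- On `[a, b]` the Gaussian density at `t` is at least `t / b` times itself. -/
lemma exp_sub_exp_div_le_stdNormalCDF_sub {a b : ℝ} (hab : a ≤ b) (hb : 0 < b) :
    (Real.exp (-a ^ 2 / 2) - Real.exp (-b ^ 2 / 2)) / (Real.sqrt (2 * Real.pi) * b) ≤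
      stdNormalCDF b - stdNormalCDF a := by
  rw [stdNormalCDF_sub_eq_integral, ← integral_mul_exp_neg_sq_div_two,
    ← intervalIntegral.integral_div]
  refine intervalIntegral.integral_mono_on hab (Continuous.intervalIntegrable (by fun_prop) _ _)
    (integrable_gaussianPDFReal 0 1).intervalIntegrable fun t ht => ?_
  have hpi : 0 < Real.sqrt (2 * Real.pi) := by positivity
  rw [gaussianPDFReal, div_le_iff₀ (by positivity)]
  simp only [NNReal.coe_one, mul_one, sub_zero]
  field_simp
  exact ht.2

lemma mul_exp_neg_half_le (α : ℝ) : α * Real.exp (-(α / 2)) ≤ 2 / Real.exp 1 := by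
  have h := Real.add_one_le_exp (α / 2 - 1)
  rw [Real.exp_sub, le_div_iff₀ (Real.exp_pos _)] at h
  rw [Real.exp_neg, le_div_iff₀ (Real.exp_pos _), ← div_eq_mul_inv, div_mul_eq_mul_div,
    div_le_iff₀ (Real.exp_pos _)]
  linarith

lemma div_two_add_le_one_sub_exp {d : ℝ} (hd : 0 ≤ d) :
    d / (2 + d) ≤ 1 - Real.exp (-(d / 2)) := by
  have h := Real.add_one_le_exp (d / 2)
  have h' : Real.exp (-(d / 2)) ≤ (d / 2 + 1)⁻¹ := by
    rw [Real.exp_neg]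
    exact inv_anti₀ (by positivity) h
  have h'' : d / (2 + d) = 1 - (d / 2 + 1)⁻¹ := by
    field_simp
    ring
  linarith

lemma exp_neg_quarter_mul_sqrt_le {α d : ℝ} (hα : 0 ≤ α) (hd : 0 ≤ d) :
    Real.exp (-(α / 4)) * Real.sqrt (α + d) ≤ Real.sqrt (2 / Real.exp 1 + d) := by
  refine Real.le_sqrt_of_sq_le ?_
  rw [mul_pow, Real.sq_sqrt (by positivity), ← Real.exp_nat_mul]
  have he : Real.exp (((2 : ℕ) : ℝ) * -(α / 4)) = Real.exp (-(α / 2)) := by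
    congr 1
    push_cast
    ring
  have h1 : Real.exp (-(α / 2)) ≤ 1 := Real.exp_le_one_iff.2 (by linarith)
  have h2 := mul_exp_neg_half_le α
  rw [he]
  nlinarith

lemma rpow_three_halves_le_of_lt_neg_two_mul_log {γ α : ℝ} (hγ : 0 < γ)
    (hα : α < -2 * Real.log (2 * γ)) :
    2 * γ ^ ((3 : ℝ) / 2) ≤ Real.exp (-(3 * α / 4)) / Real.sqrt 2 := by
  have h : γ ≤ Real.exp (-(α / 2)) / 2 := by
    have : 2 * γ ≤ Real.exp (-(α / 2)) :=
      (Real.log_le_iff_le_exp (by positivity)).1 (by linarith)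
    linarith
  have h2 : (2 : ℝ) ^ ((3 : ℝ) / 2) = 2 * Real.sqrt 2 := by
    rw [show (3 : ℝ) / 2 = 1 + 1 / 2 by norm_num, Real.rpow_add two_pos, Real.rpow_one,
      Real.sqrt_eq_rpow]
  calc 2 * γ ^ ((3 : ℝ) / 2) ≤ 2 * (Real.exp (-(α / 2)) / 2) ^ ((3 : ℝ) / 2) := by gcongr
    _ = Real.exp (-(3 * α / 4)) / Real.sqrt 2 := by
      rw [Real.div_rpow (Real.exp_pos _).le two_pos.le, ← Real.exp_mul, h2,
        show -(α / 2) * (3 / 2) = -(3 * α / 4) by ring]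
      field_simp

/-- **Lower bound on the change of `Φ(√·)`.** For all `0 < γ ≤ 1`, `Δ0 > 0`,
`0 < α < −2·ln(2γ)`, and `Δ ≥ Δ0`,
`Φ(√(α+Δ)) − Φ(√α) ≥ (2/√π) · γ^{3/2} · Δ0 / (√(2/e + Δ0) · (2 + Δ0))`. -/
theorem phi_sqrt_increment_lower_bound
    (γ Δ0 α Δ : ℝ) (hγ0 : 0 < γ) (hγ1 : γ ≤ 1) (hΔ0 : 0 < Δ0)
    (hα0 : 0 < α) (hα1 : α < -2 * Real.log (2 * γ)) (hΔ : Δ ≥ Δ0) :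
    stdNormalCDF (Real.sqrt (α + Δ)) - stdNormalCDF (Real.sqrt α)
      ≥ 2 / Real.sqrt Real.pi * γ ^ ((3 : ℝ) / 2) * Δ0
          / (Real.sqrt (2 / Real.exp 1 + Δ0) * (2 + Δ0)) := by
  have hmono : stdNormalCDF (Real.sqrt (α + Δ0)) ≤ stdNormalCDF (Real.sqrt (α + Δ)) :=
    stdNormalCDF_mono (Real.sqrt_le_sqrt (by linarith))
  have hb : 0 < Real.sqrt (α + Δ0) := Real.sqrt_pos.2 (by positivity)
  have hdensity := exp_sub_exp_div_le_stdNormalCDF_sub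
    (Real.sqrt_le_sqrt (show α ≤ α + Δ0 by linarith)) hb
  rw [Real.sq_sqrt hα0.le, Real.sq_sqrt (by positivity)] at hdensity
  have hfactor : Real.exp (-α / 2) - Real.exp (-(α + Δ0) / 2) =
      Real.exp (-(3 * α / 4)) * Real.exp (α / 4) * (1 - Real.exp (-(Δ0 / 2))) := by
    rw [mul_sub, ← Real.exp_add, ← Real.exp_add, mul_one]
    ring_nf
  have hsqrt : Real.sqrt (α + Δ0) ≤ Real.exp (α / 4) * Real.sqrt (2 / Real.exp 1 + Δ0) := by
    have h := exp_neg_quarter_mul_sqrt_le hα0.le hΔ0.le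
    rwa [Real.exp_neg, inv_mul_le_iff₀ (Real.exp_pos _)] at h
  refine le_trans ?_ (hdensity.trans (by linarith))
  calc 2 / Real.sqrt Real.pi * γ ^ ((3 : ℝ) / 2) * Δ0
          / (Real.sqrt (2 / Real.exp 1 + Δ0) * (2 + Δ0))
      = (2 * γ ^ ((3 : ℝ) / 2)) * (Δ0 / (2 + Δ0))
          / (Real.sqrt Real.pi * Real.sqrt (2 / Real.exp 1 + Δ0)) := by
        field_simp
    _ ≤ (Real.exp (-(3 * α / 4)) / Real.sqrt 2) * (1 - Real.exp (-(Δ0 / 2)))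
          / (Real.sqrt Real.pi * Real.sqrt (2 / Real.exp 1 + Δ0)) := by
        gcongr
        · exact rpow_three_halves_le_of_lt_neg_two_mul_log hγ0 hα1
        · exact div_two_add_le_one_sub_exp hΔ0.le
    _ = Real.exp (-(3 * α / 4)) * Real.exp (α / 4) * (1 - Real.exp (-(Δ0 / 2)))
          / (Real.sqrt (2 * Real.pi) *
            (Real.exp (α / 4) * Real.sqrt (2 / Real.exp 1 + Δ0))) := by
        rw [Real.sqrt_mul two_pos.le]
        field_simp
    _ ≤ (Real.exp (-α / 2) - Real.exp (-(α + Δ0) / 2))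
          / (Real.sqrt (2 * Real.pi) * Real.sqrt (α + Δ0)) := by
        rw [hfactor]
        have : 0 ≤ 1 - Real.exp (-(Δ0 / 2)) :=
          (div_two_add_le_one_sub_exp hΔ0.le).trans' (by positivity)
        gcongr
end

section
/- For all real numbers γ with 0 < γ ≤ 1, all Δ0 with 0 < Δ0 ≤ 1, all Δ ≥ Δ0, and all α with 0 ≤ α ≤ −2·ln(2γ), it holds that Φ(√(α + Δ)) − Φ(√α) ≥ (1/4) · γ^{3/2} · Δ0. -/
open MeasureTheory ProbabilityTheory

lemma gaussianPDFReal_zero_one_apply (x : ℝ) :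
    gaussianPDFReal 0 1 x = (Real.sqrt (2 * Real.pi))⁻¹ * Real.exp (-x ^ 2 / 2) := by
  simp [gaussianPDFReal]

lemma gaussianPDFReal_zero_one_le {x y : ℝ} (hx : 0 ≤ x) (hxy : x ≤ y) :
    gaussianPDFReal 0 1 y ≤ gaussianPDFReal 0 1 x := by
  rw [gaussianPDFReal_zero_one_apply, gaussianPDFReal_zero_one_apply]
  gcongr

/-- The increment of `Φ` over `[a, b] ⊆ [0, ∞)` is at least the length times the density at `b`. -/
lemma mul_gaussianPDFReal_le_stdNormalCDF_sub {a b : ℝ} (ha : 0 ≤ a) (hab : a ≤ b) :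
    (b - a) * gaussianPDFReal 0 1 b ≤ stdNormalCDF b - stdNormalCDF a := by
  have hint := integrable_gaussianPDFReal 0 1
  rw [stdNormalCDF_eq_integral, stdNormalCDF_eq_integral,
    intervalIntegral.integral_Iic_sub_Iic hint.integrableOn hint.integrableOn]
  calc (b - a) * gaussianPDFReal 0 1 b = ∫ _ in a..b, gaussianPDFReal 0 1 b := by simp
    _ ≤ ∫ t in a..b, gaussianPDFReal 0 1 t :=
      intervalIntegral.integral_mono_on hab (by simp) hint.intervalIntegrable
        fun t ht => gaussianPDFReal_zero_one_le (ha.trans ht.1) ht.2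

lemma div_two_mul_sqrt_le_sqrt_add_sub_sqrt {x d : ℝ} (hx : 0 ≤ x) (hd : 0 < d) :
    d / (2 * Real.sqrt (x + d)) ≤ Real.sqrt (x + d) - Real.sqrt x := by
  have hb : 0 < Real.sqrt (x + d) := Real.sqrt_pos.2 (by linarith)
  rw [div_le_iff₀ (by positivity)]
  nlinarith [Real.sq_sqrt hx, Real.sq_sqrt (by linarith : 0 ≤ x + d),
    sq_nonneg (Real.sqrt (x + d) - Real.sqrt x)]

lemma pi_mul_add_one_le_exp {α : ℝ} (hα : 0 ≤ α) :
    Real.pi * (α + 1) ≤ 16 * Real.exp (α / 2 - 1) := by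
  have h1 : (α + 1) / 2 ≤ Real.exp ((α - 1) / 2) := by
    linarith [Real.add_one_le_exp ((α - 1) / 2)]
  have h2 : (1 : ℝ) / 2 ≤ Real.exp (-(1 / 2)) := by
    linarith [Real.add_one_le_exp (-(1 / 2) : ℝ)]
  have h3 : Real.exp (α / 2 - 1) = Real.exp ((α - 1) / 2) * Real.exp (-(1 / 2)) := by
    rw [← Real.exp_add]; ring_nf
  have h4 := mul_le_mul h1 h2 (by norm_num) (Real.exp_pos _).le
  rw [h3]
  nlinarith [Real.pi_le_four]

lemma quarter_rpow_le_gaussianPDFReal_div {γ α : ℝ} (hγ : 0 < γ) (hα0 : 0 ≤ α)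
    (hα1 : α ≤ -2 * Real.log (2 * γ)) :
    1 / 4 * γ ^ ((3 : ℝ) / 2) ≤
      gaussianPDFReal 0 1 (Real.sqrt (α + 1)) / (2 * Real.sqrt (α + 1)) := by
  have hγα : γ ≤ Real.exp (-α / 2) / 2 := by
    have h : 2 * γ ≤ Real.exp (-α / 2) :=
      (Real.log_le_iff_le_exp (by positivity)).1 (by linarith)
    linarith
  have hcube : γ ^ 3 ≤ Real.exp (-α / 2) ^ 3 / 8 := by
    calc γ ^ 3 ≤ (Real.exp (-α / 2) / 2) ^ 3 := by gcongr
      _ = Real.exp (-α / 2) ^ 3 / 8 := by ring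
  have hrpow : (γ ^ ((3 : ℝ) / 2)) ^ 2 = γ ^ 3 := by
    rw [← Real.rpow_natCast, ← Real.rpow_mul hγ.le, ← Real.rpow_natCast]
    norm_num
  have hexp : Real.exp (-α / 2) ^ 3 * Real.exp (α / 2 - 1) =
      Real.exp (-(α + 1) / 2) ^ 2 := by
    rw [← Real.exp_nat_mul, ← Real.exp_nat_mul, ← Real.exp_add]
    push_cast
    ring_nf
  have hα : 0 < α + 1 := by linarith
  refine le_of_sq_le_sq ?_ (div_nonneg (gaussianPDFReal_nonneg _ _ _) (by positivity))
  rw [gaussianPDFReal_zero_one_apply, Real.sq_sqrt hα.le, mul_pow, hrpow, div_pow _ (2 * _),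
    mul_pow _ (Real.exp _), mul_pow 2, inv_pow, Real.sq_sqrt (by positivity), Real.sq_sqrt hα.le,
    ← hexp, le_div_iff₀ (by positivity), inv_mul_eq_div, le_div_iff₀ (by positivity)]
  calc (1 / 4) ^ 2 * γ ^ 3 * (2 ^ 2 * (α + 1)) * (2 * Real.pi)
      = γ ^ 3 * (Real.pi * (α + 1)) / 2 := by ring
    _ ≤ Real.exp (-α / 2) ^ 3 / 8 * (16 * Real.exp (α / 2 - 1)) / 2 := by
      gcongr ?_ / 2
      exact mul_le_mul hcube (pi_mul_add_one_le_exp hα0) (by positivity) (by positivity)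
    _ = Real.exp (-α / 2) ^ 3 * Real.exp (α / 2 - 1) := by ring

/-- **Combined AUC-improvement bound.** For all `0 < γ ≤ 1`, `0 < Δ0 ≤ 1`, `Δ ≥ Δ0`,
and `0 ≤ α ≤ −2·ln(2γ)`, it holds that
`Φ(√(α+Δ)) − Φ(√α) ≥ (1/4) · γ^{3/2} · Δ0`. -/
theorem phi_sqrt_increment_quarter_bound
    (γ Δ0 Δ α : ℝ) (hγ0 : 0 < γ) (hγ1 : γ ≤ 1) (hΔ00 : 0 < Δ0) (hΔ01 : Δ0 ≤ 1)
    (hΔ : Δ ≥ Δ0) (hα0 : 0 ≤ α) (hα1 : α ≤ -2 * Real.log (2 * γ)) :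
    stdNormalCDF (Real.sqrt (α + Δ)) - stdNormalCDF (Real.sqrt α)
      ≥ 1 / 4 * γ ^ ((3 : ℝ) / 2) * Δ0 := by
  have hb : 0 < Real.sqrt (α + Δ0) := Real.sqrt_pos.2 (by linarith)
  have hb1 : Real.sqrt (α + Δ0) ≤ Real.sqrt (α + 1) := Real.sqrt_le_sqrt (by linarith)
  calc 1 / 4 * γ ^ ((3 : ℝ) / 2) * Δ0
      ≤ gaussianPDFReal 0 1 (Real.sqrt (α + 1)) / (2 * Real.sqrt (α + 1)) * Δ0 := by
        gcongr
        exact quarter_rpow_le_gaussianPDFReal_div hγ0 hα0 hα1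
    _ ≤ gaussianPDFReal 0 1 (Real.sqrt (α + Δ0)) / (2 * Real.sqrt (α + Δ0)) * Δ0 := by
        have h := gaussianPDFReal_zero_one_le hb.le hb1
        have h0 := gaussianPDFReal_nonneg 0 1 (Real.sqrt (α + Δ0))
        gcongr
    _ = Δ0 / (2 * Real.sqrt (α + Δ0)) * gaussianPDFReal 0 1 (Real.sqrt (α + Δ0)) := by ring
    _ ≤ (Real.sqrt (α + Δ0) - Real.sqrt α) * gaussianPDFReal 0 1 (Real.sqrt (α + Δ0)) :=
        mul_le_mul_of_nonneg_right (div_two_mul_sqrt_le_sqrt_add_sub_sqrt hα0 hΔ00)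
          (gaussianPDFReal_nonneg _ _ _)
    _ ≤ stdNormalCDF (Real.sqrt (α + Δ0)) - stdNormalCDF (Real.sqrt α) :=
        mul_gaussianPDFReal_le_stdNormalCDF_sub (Real.sqrt_nonneg _)
          (Real.sqrt_le_sqrt (by linarith))
    _ ≤ stdNormalCDF (Real.sqrt (α + Δ)) - stdNormalCDF (Real.sqrt α) := by
        gcongr
        exact stdNormalCDF_mono (Real.sqrt_le_sqrt (by linarith))
end

section
/- Let M ∈ ℝ^{(d+1)×(d+1)} be a symmetric positive definite matrix, u ∈ ℝ^{d+1}, and w ∈ ℝ^d with w ≠ 0. Let T be the 2×(d+1) matrix whose first row is (w₁, …, w_d, 0) and whose second row is (0, …, 0, 1). Then T·M·Tᵀ is positive definite (in particular invertible) and (T·u)ᵀ (T·M·Tᵀ)⁻¹ (T·u) ≤ uᵀ M⁻¹ u. -/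
open Matrix

/-- The `2 × (d+1)` matrix whose first row is `(w₁, …, w_d, 0)` and whose second row is
`(0, …, 0, 1)`. -/
def projMat {d : ℕ} (w : Fin d → ℝ) : Matrix (Fin 2) (Fin (d + 1)) ℝ :=
  Matrix.of ![Fin.snoc w 0, Fin.snoc (0 : Fin d → ℝ) 1]

theorem Matrix.PosDef.mulVec_dotProduct_inv_mulVec_le {m n : Type*} [Fintype m] [Fintype n]
    [DecidableEq m] [DecidableEq n] {M : Matrix n n ℝ} (hM : M.PosDef) (T : Matrix m n ℝ)
    (hT : (T * M * Tᵀ).PosDef) (u : n → ℝ) :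
    T *ᵥ u ⬝ᵥ (T * M * Tᵀ)⁻¹ *ᵥ (T *ᵥ u) ≤ u ⬝ᵥ M⁻¹ *ᵥ u := by
  set y := (T * M * Tᵀ)⁻¹ *ᵥ (T *ᵥ u) with hy
  set x := M⁻¹ *ᵥ u with hx
  have hMx : M *ᵥ x = u := by
    rw [hx, mulVec_mulVec, mul_nonsing_inv _ ((isUnit_iff_isUnit_det _).1 hM.isUnit), one_mulVec]
  have hSy : T *ᵥ (M *ᵥ (Tᵀ *ᵥ y)) = T *ᵥ u := by
    rw [mulVec_mulVec, mulVec_mulVec, hy, mulVec_mulVec,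
      mul_nonsing_inv _ ((isUnit_iff_isUnit_det _).1 hT.isUnit), one_mulVec]
  have hadj (v : n → ℝ) : Tᵀ *ᵥ y ⬝ᵥ v = T *ᵥ v ⬝ᵥ y := by
    rw [mulVec_transpose, ← dotProduct_mulVec, dotProduct_comm]
  have hMt : Mᵀ = M := by simpa using hM.isHermitian.eq
  have hxy : x ⬝ᵥ M *ᵥ (Tᵀ *ᵥ y) = T *ᵥ u ⬝ᵥ y := by
    rw [dotProduct_mulVec, ← mulVec_transpose, hMt, hMx, dotProduct_comm, hadj]
  have key := hM.posSemidef.dotProduct_mulVec_nonneg (x - Tᵀ *ᵥ y)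
  simp only [star_trivial, mulVec_sub, sub_dotProduct, dotProduct_sub] at key
  rw [hxy, hMx, hadj, hadj, hSy, dotProduct_comm x u] at key
  linarith

theorem vecMul_projMat_injective {d : ℕ} {w : Fin d → ℝ} (hw : w ≠ 0) :
    Function.Injective (projMat w).vecMul := by
  obtain ⟨i, hi⟩ := Function.ne_iff.1 hw
  intro a b hab
  have h0 := congrFun hab i.castSucc
  have h1 := congrFun hab (Fin.last d)
  simp only [vecMul, dotProduct, projMat, of_apply, Fin.sum_univ_two, cons_val_zero, cons_val_one,
    Fin.snoc_castSucc, Fin.snoc_last, Pi.zero_apply, mul_zero, add_zero, zero_add, mul_one]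
    at h0 h1
  ext j
  fin_cases j
  · exact mul_right_cancel₀ hi h0
  · exact h1

/-- **Projection does not increase the quadratic form.** For a symmetric positive definite
matrix `M ∈ ℝ^{(d+1)×(d+1)}`, a vector `u ∈ ℝ^{d+1}`, and a nonzero `w ∈ ℝ^d`, letting `T`
be the `2×(d+1)` matrix with rows `(w, 0)` and `(0, …, 0, 1)`, the matrix `T·M·Tᵀ` is
positive definite and `(Tu)ᵀ (TMTᵀ)⁻¹ (Tu) ≤ uᵀ M⁻¹ u`. -/
theorem projection_quadform_le
    {d : ℕ} (M : Matrix (Fin (d + 1)) (Fin (d + 1)) ℝ) (hM : M.PosDef)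
    (u : Fin (d + 1) → ℝ) (w : Fin d → ℝ) (hw : w ≠ 0) :
    (projMat w * M * (projMat w)ᵀ).PosDef ∧
    ((projMat w).mulVec u) ⬝ᵥ (projMat w * M * (projMat w)ᵀ)⁻¹.mulVec ((projMat w).mulVec u)
      ≤ u ⬝ᵥ M⁻¹.mulVec u := by
  have hT : (projMat w * M * (projMat w)ᵀ).PosDef := by
    simpa using hM.mul_mul_conjTranspose_same (vecMul_projMat_injective hw)
  exact ⟨hT, hM.mulVec_dotProduct_inv_mulVec_le _ hT u⟩
end

section
/- Let d ≥ 1, let Δμ ∈ ℝ^d be nonzero, let Σ ∈ ℝ^{d×d}, r ∈ ℝ^d, and σ² > 0 be such that the (d+1)×(d+1) block matrix M := [[Σ, r], [rᵀ, σ²]] is symmetric positive definite. Define s := Δμᵀ Σ⁻¹ Δμ, ρ := (Σ⁻¹ Δμ)ᵀ r, and γ := 1 − Φ(√s). Let Δv > 0 satisfy |ρ| ≤ Δv and (Δv − |ρ|)² ≤ σ², and set u := (Δμ, Δv) ∈ ℝ^{d+1}. Then: (i) uᵀ M⁻¹ u ≥ s + (Δv − ρ)²/σ²; and (ii) Φ(√(uᵀ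 M⁻¹ u)) − Φ(√s) ≥ (1/4) · γ^{3/2} · (Δv − |ρ|)²/σ². -/
open MeasureTheory ProbabilityTheory Matrix

/-- The `(d+1)×(d+1)` block matrix `[[S, r], [rᵀ, σsq]]`. -/
def blockMat {d : ℕ} (S : Matrix (Fin d) (Fin d) ℝ) (r : Fin d → ℝ) (σsq : ℝ) :
    Matrix (Fin d ⊕ Fin 1) (Fin d ⊕ Fin 1) ℝ :=
  Matrix.fromBlocks S (Matrix.of fun i _ => r i) (Matrix.of fun _ j => r j)
    (Matrix.of fun _ _ => σsq)

/-- The upper tail of the standard normal distribution as an integral of its density. -/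
theorem one_sub_stdNormalCDF_eq_integral (x : ℝ) :
    1 - stdNormalCDF x = ∫ y in Set.Ioi x, gaussianPDFReal 0 1 y := by
  have h1 : 1 - stdNormalCDF x = (gaussianReal 0 1).real (Set.Ioi x) := by
    rw [← Set.compl_Iic, probReal_compl_eq_one_sub measurableSet_Iic]
    rfl
  rw [h1, Measure.real, gaussianReal_apply_eq_integral 0 one_ne_zero, ENNReal.toReal_ofReal]
  exact setIntegral_nonneg measurableSet_Ioi fun y _ => gaussianPDFReal_nonneg 0 1 y

theorem one_sub_stdNormalCDF_nonneg (x : ℝ) : 0 ≤ 1 - stdNormalCDF x := by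
  rw [one_sub_stdNormalCDF_eq_integral]
  exact setIntegral_nonneg measurableSet_Ioi fun y _ => gaussianPDFReal_nonneg 0 1 y

theorem stdNormalCDF_nonneg (x : ℝ) : 0 ≤ stdNormalCDF x := ENNReal.toReal_nonneg

/-- Translating the tail from `a` to `b` costs at least a factor `exp (-(b² - a²) / 2)`. -/
theorem one_sub_stdNormalCDF_le_exp_mul {a b t : ℝ} (hab : a ≤ b) (ht : a ^ 2 + t ≤ b ^ 2) :
    1 - stdNormalCDF b ≤ Real.exp (-t / 2) * (1 - stdNormalCDF a) := by
  rw [one_sub_stdNormalCDF_eq_integral, one_sub_stdNormalCDF_eq_integral]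
  have hshift := (measurePreserving_add_right (volume : Measure ℝ) (b - a)).setIntegral_preimage_emb
    (measurableEmbedding_addRight (b - a)) (gaussianPDFReal 0 1) (Set.Ioi b)
  have hpre : (fun x => x + (b - a)) ⁻¹' Set.Ioi b = Set.Ioi a := by
    ext x
    simp only [Set.mem_preimage, Set.mem_Ioi]
    constructor <;> intro h <;> linarith
  rw [← hshift, hpre, ← integral_const_mul]
  have hint := integrable_gaussianPDFReal 0 1
  refine setIntegral_mono_on (hint.comp_add_right (b - a)).integrableOn
    (hint.const_mul _).integrableOn measurableSet_Ioi fun x hx => ?_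
  rw [gaussianPDFReal_def]
  simp only [NNReal.coe_one, mul_one, sub_zero]
  rw [mul_left_comm, ← Real.exp_add]
  gcongr
  nlinarith [mul_nonneg (sub_nonneg.2 hab) (sub_nonneg.2 (Set.mem_Ioi.1 hx).le)]

theorem exp_neg_half_le {t : ℝ} (h0 : 0 ≤ t) (h1 : t ≤ 1) : Real.exp (-t / 2) ≤ 1 - t / 4 := by
  rw [neg_div, Real.exp_neg]
  refine inv_le_of_inv_le₀ (by linarith) ?_
  refine le_trans ?_ (Real.add_one_le_exp (t / 2))
  rw [inv_le_iff_one_le_mul₀ (by linarith)]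
  nlinarith

theorem stdNormalCDF_sub_ge {a b t : ℝ} (hab : a ≤ b) (ht : a ^ 2 + t ≤ b ^ 2)
    (h0 : 0 ≤ t) (h1 : t ≤ 1) :
    1 / 4 * (1 - stdNormalCDF a) ^ ((3 : ℝ) / 2) * t ≤ stdNormalCDF b - stdNormalCDF a := by
  have hQ := one_sub_stdNormalCDF_nonneg a
  have hpow : (1 - stdNormalCDF a) ^ ((3 : ℝ) / 2) ≤ 1 - stdNormalCDF a :=
    Real.rpow_le_self_of_le_one hQ (by linarith [stdNormalCDF_nonneg a]) (by norm_num)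
  have htail := one_sub_stdNormalCDF_le_exp_mul hab ht
  have hexp := mul_le_mul_of_nonneg_right (exp_neg_half_le h0 h1) hQ
  have := mul_le_mul_of_nonneg_right hpow h0
  linarith

theorem blockMat_mulVec_sumElim {d : ℕ} (S : Matrix (Fin d) (Fin d) ℝ) (r : Fin d → ℝ)
    (σsq : ℝ) (x : Fin d → ℝ) (c : ℝ) :
    blockMat S r σsq *ᵥ Sum.elim x (fun _ => c)
      = Sum.elim (S *ᵥ x + c • r) (fun _ => r ⬝ᵥ x + σsq * c) := by
  ext i
  cases i <;> simp [blockMat, mulVec, dotProduct, mul_comm]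

theorem posDef_of_blockMat {d : ℕ} {S : Matrix (Fin d) (Fin d) ℝ} {r : Fin d → ℝ} {σsq : ℝ}
    (hM : (blockMat S r σsq).PosDef) : S.PosDef :=
  hM.submatrix (e := Sum.inl) Sum.inl_injective

/-- The Schur complement of `S` in a positive definite block matrix is positive. -/
theorem schur_pos_of_blockMat {d : ℕ} {S : Matrix (Fin d) (Fin d) ℝ} {r : Fin d → ℝ} {σsq : ℝ}
    (hM : (blockMat S r σsq).PosDef) : 0 < σsq - r ⬝ᵥ S⁻¹ *ᵥ r := by
  have hdet : IsUnit S.det := S.isUnit_iff_isUnit_det.1 (posDef_of_blockMat hM).isUnit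
  have hne : Sum.elim (-(S⁻¹ *ᵥ r)) (fun _ : Fin 1 => (1 : ℝ)) ≠ 0 := fun h => by
    simpa using congrFun h (Sum.inr 0)
  have hpos := hM.dotProduct_mulVec_pos hne
  rw [blockMat_mulVec_sumElim, star_trivial, sumElim_dotProduct_sumElim, mulVec_neg,
    mulVec_mulVec, mul_nonsing_inv S hdet] at hpos
  simp only [one_mulVec, one_smul, neg_add_cancel, dotProduct_zero, dotProduct_neg] at hpos
  simp [dotProduct] at hpos ⊢
  linarith

/-- Inversion of the quadratic form of a block matrix through the Schur complement. -/
theorem blockMat_inv_quadForm {d : ℕ} {S : Matrix (Fin d) (Fin d) ℝ} {r : Fin d → ℝ} {σsq : ℝ}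
    (hM : (blockMat S r σsq).PosDef) (x : Fin d → ℝ) (c : ℝ) :
    Sum.elim x (fun _ => c) ⬝ᵥ (blockMat S r σsq)⁻¹ *ᵥ Sum.elim x (fun _ => c)
      = x ⬝ᵥ S⁻¹ *ᵥ x + (c - S⁻¹ *ᵥ x ⬝ᵥ r) ^ 2 / (σsq - r ⬝ᵥ S⁻¹ *ᵥ r) := by
  have hS := posDef_of_blockMat hM
  have hdet : IsUnit S.det := S.isUnit_iff_isUnit_det.1 hS.isUnit
  have hMdet : IsUnit (blockMat S r σsq).det :=
    (blockMat S r σsq).isUnit_iff_isUnit_det.1 hM.isUnit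
  have hκ := schur_pos_of_blockMat hM
  have hsymm : x ⬝ᵥ S⁻¹ *ᵥ r = S⁻¹ *ᵥ x ⬝ᵥ r := by
    have hT : (S⁻¹)ᵀ = S⁻¹ := by simpa using hS.inv.isHermitian.eq
    rw [dotProduct_mulVec, ← mulVec_transpose, hT]
  set κ := σsq - r ⬝ᵥ S⁻¹ *ᵥ r with hκdef
  set l := (c - S⁻¹ *ᵥ x ⬝ᵥ r) / κ with hl
  have hlκ : l * κ = c - S⁻¹ *ᵥ x ⬝ᵥ r := div_mul_cancel₀ _ hκ.ne'
  have hsolve : blockMat S r σsq *ᵥ Sum.elim (S⁻¹ *ᵥ x - l • S⁻¹ *ᵥ r) (fun _ => l)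
      = Sum.elim x (fun _ => c) := by
    rw [blockMat_mulVec_sumElim]
    congr 1
    · simp [mulVec_sub, mulVec_smul, mulVec_mulVec, mul_nonsing_inv S hdet]
    · funext _
      rw [dotProduct_sub, dotProduct_smul, dotProduct_comm r (S⁻¹ *ᵥ x), smul_eq_mul]
      linear_combination hlκ + l * hκdef
  have hinv : (blockMat S r σsq)⁻¹ *ᵥ Sum.elim x (fun _ => c)
      = Sum.elim (S⁻¹ *ᵥ x - l • S⁻¹ *ᵥ r) (fun _ => l) := by
    rw [← hsolve, mulVec_mulVec, nonsing_inv_mul _ hMdet, one_mulVec]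
  have hone : (fun _ : Fin 1 => c) ⬝ᵥ (fun _ => l) = c * l := by simp [dotProduct]
  rw [hinv, sumElim_dotProduct_sumElim, dotProduct_sub, dotProduct_smul, hsymm, smul_eq_mul, hone]
  field_simp
  linear_combination (c - S⁻¹ *ᵥ x ⬝ᵥ r) * hlκ

/-- **Analytic form of the fairAUC main theorem.** Let `Δμ ≠ 0`, and let
`M = [[S, r], [rᵀ, σ²]]` be symmetric positive definite with `σ² > 0`. With
`s = Δμᵀ S⁻¹ Δμ`, `ρ = (S⁻¹Δμ)ᵀ r`, `γ = 1 − Φ(√s)`, and `Δv > 0` satisfying `|ρ| ≤ Δv`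
and `(Δv − |ρ|)² ≤ σ²`, and `u = (Δμ, Δv)`:
(i) `uᵀ M⁻¹ u ≥ s + (Δv − ρ)²/σ²`; and
(ii) `Φ(√(uᵀ M⁻¹ u)) − Φ(√s) ≥ (1/4) · γ^{3/2} · (Δv − |ρ|)²/σ²`. -/
theorem fairAUC_improvement_bound
    {d : ℕ} (hd : 1 ≤ d) (Δμ : Fin d → ℝ) (hΔμ : Δμ ≠ 0)
    (S : Matrix (Fin d) (Fin d) ℝ) (r : Fin d → ℝ) (σsq : ℝ) (hσ : 0 < σsq)
    (hM : (blockMat S r σsq).PosDef)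
    (Δv : ℝ) (hΔv : 0 < Δv)
    (hρ1 : |S⁻¹.mulVec Δμ ⬝ᵥ r| ≤ Δv)
    (hρ2 : (Δv - |S⁻¹.mulVec Δμ ⬝ᵥ r|) ^ 2 ≤ σsq) :
    Sum.elim Δμ (fun _ => Δv) ⬝ᵥ (blockMat S r σsq)⁻¹.mulVec (Sum.elim Δμ fun _ => Δv)
        ≥ Δμ ⬝ᵥ S⁻¹.mulVec Δμ + (Δv - S⁻¹.mulVec Δμ ⬝ᵥ r) ^ 2 / σsq ∧
    stdNormalCDF (Real.sqrt
          (Sum.elim Δμ (fun _ => Δv) ⬝ᵥ (blockMat S r σsq)⁻¹.mulVec (Sum.elim Δμ fun _ => Δv)))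
        - stdNormalCDF (Real.sqrt (Δμ ⬝ᵥ S⁻¹.mulVec Δμ))
      ≥ 1 / 4 * (1 - stdNormalCDF (Real.sqrt (Δμ ⬝ᵥ S⁻¹.mulVec Δμ))) ^ ((3 : ℝ) / 2)
          * (Δv - |S⁻¹.mulVec Δμ ⬝ᵥ r|) ^ 2 / σsq := by
  have hSinv := (posDef_of_blockMat hM).inv.posSemidef
  have hκ := schur_pos_of_blockMat hM
  have hr : 0 ≤ r ⬝ᵥ S⁻¹ *ᵥ r := by simpa using hSinv.dotProduct_mulVec_nonneg r
  have hs : 0 ≤ Δμ ⬝ᵥ S⁻¹ *ᵥ Δμ := by simpa using hSinv.dotProduct_mulVec_nonneg Δμ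
  have hquad : Δμ ⬝ᵥ S⁻¹ *ᵥ Δμ + (Δv - S⁻¹ *ᵥ Δμ ⬝ᵥ r) ^ 2 / σsq
      ≤ Sum.elim Δμ (fun _ => Δv) ⬝ᵥ (blockMat S r σsq)⁻¹ *ᵥ (Sum.elim Δμ fun _ => Δv) := by
    rw [blockMat_inv_quadForm hM]
    gcongr
    linarith
  refine ⟨hquad, ?_⟩
  generalize Sum.elim Δμ (fun _ => Δv) ⬝ᵥ
    (blockMat S r σsq)⁻¹ *ᵥ (Sum.elim Δμ fun _ => Δv) = q at hquad ⊢
  set s := Δμ ⬝ᵥ S⁻¹ *ᵥ Δμ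
  set ρ := S⁻¹ *ᵥ Δμ ⬝ᵥ r
  have ht : (Δv - |ρ|) ^ 2 / σsq ≤ (Δv - ρ) ^ 2 / σsq := by
    gcongr
    exact le_abs_self ρ
  have ht0 : 0 ≤ (Δv - |ρ|) ^ 2 / σsq := by positivity
  rw [ge_iff_le, mul_div_assoc]
  refine stdNormalCDF_sub_ge (Real.sqrt_le_sqrt (by linarith)) ?_ ht0 ((div_le_one hσ).2 hρ2)
  rw [Real.sq_sqrt hs, Real.sq_sqrt (by linarith)]
  linarith
end
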